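/- If G is a graph of order n ≥ 2, then 4 ≤ b_g(G) · b_g(complement of G) ≤ 2n. -/

import Mathlib

namespace BurningGame

/-- One spreading phase: all neighbors of burned vertices become burned. -/
noncomputable def spread {V : Type*} [Fintype V] [DecidableEq V] (G : SimpleGraph V) (B : Finset V) : Finset V :=
  ((↑B : Set V) ∪ {v | ∃ u ∈ B, G.Adj u v}).toFinite.toFinset

/-- `EndBy G turn i B k`: starting from burned set `B` at round index `i`
(the player selecting in round `i` is Burner iff `turn i = true`; Burner's selections are
quantified existentially, Staller's universally), Burner can force the game to end
within `k` further rounds. -/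
def EndBy {V : Type*} [Fintype V] [DecidableEq V] (G : SimpleGraph V) (turn : ℕ → Bool) :
    ℕ → Finset V → ℕ → Prop
  | _, B, 0 => B = Finset.univ
  | i, B, k + 1 => B = Finset.univ ∨
      spread G B = Finset.univ ∨
      (if turn i then ∃ v ∉ spread G B, EndBy G turn (i + 1) (insert v (spread G B)) k
       else ∀ v ∉ spread G B, EndBy G turn (i + 1) (insert v (spread G B)) k)

/-- Game burning number relative to a preburned set `S` (Burner starts). -/
noncomputable def bgRel {V : Type*} [Fintype V] [DecidableEq V] (G : SimpleGraph V) (S : Finset V) : ℕ :=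
  sInf {k | EndBy G (fun i => i % 2 == 0) 0 S k}

/-- The game burning number (Burner starts). -/
noncomputable def bg {V : Type*} [Fintype V] [DecidableEq V] (G : SimpleGraph V) : ℕ := bgRel G ∅

/-- The Staller-start game burning number. -/
noncomputable def bg' {V : Type*} [Fintype V] [DecidableEq V] (G : SimpleGraph V) : ℕ :=
  sInf {k | EndBy G (fun i => i % 2 == 1) 0 ∅ k}

/-- The burning number: only Burner plays. -/
noncomputable def burn {V : Type*} [Fintype V] [DecidableEq V] (G : SimpleGraph V) : ℕ :=
  sInf {k | EndBy G (fun _ => true) 0 ∅ k}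

/-- The cooling number: only Staller plays. -/
noncomputable def cool {V : Type*} [Fintype V] [DecidableEq V] (G : SimpleGraph V) : ℕ :=
  sInf {k | EndBy G (fun _ => false) 0 ∅ k}

section Aux

variable {V : Type*} [Fintype V] [DecidableEq V]

lemma mem_spread {G : SimpleGraph V} {B : Finset V} {x : V} :
    x ∈ spread G B ↔ x ∈ B ∨ ∃ u ∈ B, G.Adj u x := by
  simp [spread]

lemma subset_spread (G : SimpleGraph V) (B : Finset V) : B ⊆ spread G B :=
  fun _ hx => mem_spread.2 (Or.inl hx)

lemma spread_empty (G : SimpleGraph V) : spread G ∅ = ∅ := by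
  ext x
  simp [mem_spread]

/-- If the game can be ended in `k` further rounds after every legal selection, it can be ended
in `k + 1` rounds, whoever is to move. -/
lemma endBy_succ_of_forall {G : SimpleGraph V} {turn : ℕ → Bool} {i k : ℕ} {B : Finset V}
    (h : ∀ v ∉ spread G B, EndBy G turn (i + 1) (insert v (spread G B)) k) :
    EndBy G turn i B (k + 1) := by
  rw [EndBy]
  by_cases hs : spread G B = Finset.univ
  · exact Or.inr (Or.inl hs)
  · refine Or.inr (Or.inr ?_)
    split_ifs
    · obtain ⟨v, hv⟩ : ∃ v, v ∉ spread G B := by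
        by_contra! hall
        exact hs (Finset.eq_univ_of_forall hall)
      exact ⟨v, hv, h v hv⟩
    · exact h

lemma endBy_of_card_le (G : SimpleGraph V) (turn : ℕ → Bool) (k : ℕ) :
    ∀ (i : ℕ) (B : Finset V), Fintype.card V ≤ B.card + k → EndBy G turn i B k := by
  induction k with
  | zero =>
    intro i B h
    exact (Finset.card_eq_iff_eq_univ B).1 (le_antisymm (Finset.card_le_univ B) h)
  | succ k ih =>
    intro i B h
    refine endBy_succ_of_forall fun v hv => ih _ _ ?_
    have h1 := Finset.card_le_card (subset_spread G B)
    rw [Finset.card_insert_of_notMem hv]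
    omega

lemma bg_le_of_endBy {G : SimpleGraph V} {k : ℕ}
    (h : EndBy G (fun i => i % 2 == 0) 0 ∅ k) : bg G ≤ k :=
  Nat.sInf_le h

lemma bg_le_card (G : SimpleGraph V) : bg G ≤ Fintype.card V :=
  bg_le_of_endBy (endBy_of_card_le G _ _ _ _ (by simp))

lemma endBy_bg (G : SimpleGraph V) : EndBy G (fun i => i % 2 == 0) 0 ∅ (bg G) :=
  Nat.sInf_mem (s := {k | EndBy G (fun i => i % 2 == 0) 0 ∅ k})
    ⟨Fintype.card V, endBy_of_card_le G _ _ _ _ (by simp)⟩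

lemma two_le_bg (G : SimpleGraph V) (hn : 2 ≤ Fintype.card V) : 2 ≤ bg G := by
  have h := endBy_bg G
  have hne : (∅ : Finset V) ≠ Finset.univ := by
    intro he
    have := congrArg Finset.card he
    simp only [Finset.card_empty, Finset.card_univ] at this
    omega
  by_contra! hlt
  interval_cases hb : bg G
  · exact hne h
  · rw [EndBy, spread_empty] at h
    rcases h with h | h | h
    · exact hne h
    · exact hne h
    · obtain ⟨v, -, hv⟩ := h
      have := congrArg Finset.card (show insert v ∅ = Finset.univ from hv)
      simp only [Finset.card_univ, insert_empty_eq, Finset.card_singleton] at this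
      omega

lemma bg_le_succ_of_first {G : SimpleGraph V} {k : ℕ} (v : V)
    (h : EndBy G (fun i => i % 2 == 0) 1 {v} k) : bg G ≤ k + 1 := by
  refine bg_le_of_endBy ?_
  rw [EndBy]
  refine Or.inr (Or.inr ?_)
  rw [if_pos (by rfl), spread_empty]
  exact ⟨v, by simp, by simpa using h⟩

/-- A vertex with at most one non-neighbor lets Burner finish within two rounds. -/
lemma bg_le_two {G : SimpleGraph V} (v : V)
    (h : ∀ x y, x ≠ v → ¬ G.Adj v x → y ≠ v → ¬ G.Adj v y → x = y) : bg G ≤ 2 := by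
  refine bg_le_succ_of_first v (endBy_succ_of_forall fun w hw => ?_)
  have hw' : w ≠ v ∧ ¬ G.Adj v w := by simpa [mem_spread] using hw
  refine Finset.eq_univ_of_forall fun x => ?_
  by_cases hx : x = v ∨ G.Adj v x
  · simpa [mem_spread] using Or.inr hx
  · push Not at hx
    simp [h x w hx.1 hx.2 hw'.1 hw'.2]

/-- A vertex of eccentricity at most two lets Burner finish within three rounds. -/
lemma bg_le_three {G : SimpleGraph V} (u : V)
    (h : ∀ x, x = u ∨ G.Adj u x ∨ ∃ w, G.Adj u w ∧ G.Adj w x) : bg G ≤ 3 := by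
  refine bg_le_succ_of_first u (endBy_succ_of_forall fun w hw => ?_)
  rw [EndBy]
  refine Or.inr (Or.inl (Finset.eq_univ_of_forall fun x => ?_))
  have hu : u ∈ insert w (spread G {u}) := by simp [mem_spread]
  rcases h x with rfl | hx | ⟨y, hy, hyx⟩
  · exact mem_spread.2 (Or.inl hu)
  · exact mem_spread.2 (Or.inr ⟨u, hu, hx⟩)
  · exact mem_spread.2 (Or.inr ⟨y, by simp [mem_spread, hy], hyx⟩)

/-- If every vertex has at least two neighbors, then on average every round burns at least two
vertices, regardless of how the players select. -/
lemma endBy_of_two_neighbors {G : SimpleGraph V}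
    (hd : ∀ v, ∃ x y, x ≠ y ∧ G.Adj v x ∧ G.Adj v y) (turn : ℕ → Bool) (k : ℕ) :
    ∀ (i : ℕ) (B : Finset V), Fintype.card V ≤ B.card + 2 * k → EndBy G turn i B k := by
  induction k using Nat.strong_induction_on with
  | _ k ih =>
  intro i B h
  obtain _ | k := k
  · exact endBy_of_card_le G turn 0 i B h
  refine endBy_succ_of_forall fun v hv => ?_
  by_cases hs : spread G B = B
  · have hclosed : ∀ x, G.Adj v x → x ∉ B := fun x hx hxB =>
      hv (mem_spread.2 (Or.inr ⟨x, hxB, hx.symm⟩))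
    rw [hs] at hv ⊢
    obtain ⟨x, y, hxy, hx, hy⟩ := hd v
    have hcard : (insert x (insert y (insert v B))).card = B.card + 3 := by
      rw [Finset.card_insert_of_notMem, Finset.card_insert_of_notMem,
        Finset.card_insert_of_notMem hv]
      · simp [hy.ne', hclosed y hy]
      · simp [hxy, hx.ne', hclosed x hx]
    obtain _ | k := k
    · have := Finset.card_le_univ (insert x (insert y (insert v B)))
      omega
    · refine endBy_succ_of_forall fun w hw => ih k (by omega) _ _ ?_
      have hsub : insert x (insert y (insert v B)) ⊆ spread G (insert v B) := by
        intro z hz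
        simp only [Finset.mem_insert] at hz
        rcases hz with rfl | rfl | hz
        · exact mem_spread.2 (Or.inr ⟨v, by simp, hx⟩)
        · exact mem_spread.2 (Or.inr ⟨v, by simp, hy⟩)
        · exact mem_spread.2 (Or.inl (by simpa using hz))
      have := Finset.card_le_card hsub
      rw [Finset.card_insert_of_notMem hw]
      omega
  · refine ih k (by omega) _ _ ?_
    have := Finset.card_lt_card ((subset_spread G B).ssubset_of_ne (Ne.symm hs))
    rw [Finset.card_insert_of_notMem hv]
    omega

lemma two_mul_bg_le {G : SimpleGraph V}
    (hd : ∀ v, ∃ x y, x ≠ y ∧ G.Adj v x ∧ G.Adj v y) : 2 * bg G ≤ Fintype.card V + 1 := by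
  have : bg G ≤ (Fintype.card V + 1) / 2 :=
    bg_le_of_endBy (endBy_of_two_neighbors hd _ _ _ _ (by rw [Finset.card_empty]; omega))
  omega

lemma bg_compl_le_two_or (G : SimpleGraph V) :
    bg Gᶜ ≤ 2 ∨ ∀ v, ∃ x y, x ≠ y ∧ G.Adj v x ∧ G.Adj v y := by
  by_contra! hcon
  obtain ⟨h2, v, hv⟩ := hcon
  refine absurd (bg_le_two (G := Gᶜ) v fun x y hx hvx hy hvy => ?_) (not_le.2 h2)
  rw [SimpleGraph.compl_adj] at hvx hvy
  by_contra hne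
  exact hv x y hne (by tauto) (by tauto)

lemma bg_le_three_or_compl [Nonempty V] (G : SimpleGraph V) : bg G ≤ 3 ∨ bg Gᶜ ≤ 3 := by
  obtain ⟨u⟩ := ‹Nonempty V›
  by_cases h : ∀ x, x = u ∨ G.Adj u x ∨ ∃ w, G.Adj u w ∧ G.Adj w x
  · exact Or.inl (bg_le_three u h)
  · push Not at h
    obtain ⟨x, hxu, hux, hx⟩ := h
    refine Or.inr (bg_le_three u fun y => ?_)
    by_cases hyu : y = u
    · exact Or.inl hyu
    by_cases huy : G.Adj u y
    · refine Or.inr (Or.inr ⟨x, ?_, ?_⟩)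
      · exact (SimpleGraph.compl_adj _ _ _).2 ⟨hxu.symm, hux⟩
      · refine (SimpleGraph.compl_adj _ _ _).2 ⟨?_, fun hxy => hx y huy hxy.symm⟩
        rintro rfl
        exact hux huy
    · exact Or.inr (Or.inl ((SimpleGraph.compl_adj _ _ _).2 ⟨Ne.symm hyu, huy⟩))

end Aux

theorem stmt13 {V : Type*} [Fintype V] [DecidableEq V] (G : SimpleGraph V)
    (hn : 2 ≤ Fintype.card V) :
    4 ≤ bg G * bg Gᶜ ∧ bg G * bg Gᶜ ≤ 2 * Fintype.card V := by
  refine ⟨Nat.mul_le_mul (two_le_bg G hn) (two_le_bg Gᶜ hn), ?_⟩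
  rcases bg_compl_le_two_or G with h | hG
  · exact (Nat.mul_le_mul (bg_le_card G) h).trans_eq (mul_comm _ _)
  rcases bg_compl_le_two_or Gᶜ with h | hGc
  · rw [compl_compl] at h
    exact Nat.mul_le_mul h (bg_le_card Gᶜ)
  have hne : Nonempty V := Fintype.card_pos_iff.1 (by omega)
  have hcard : 3 ≤ Fintype.card V := by
    obtain ⟨v⟩ := hne
    obtain ⟨x, y, hxy, hx, hy⟩ := hG v
    rw [← Finset.card_eq_three.2 ⟨v, x, y, hx.ne, hy.ne, hxy, rfl⟩]
    exact Finset.card_le_univ _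
  have h1 := two_mul_bg_le hG
  have h2 := two_mul_bg_le hGc
  rcases bg_le_three_or_compl G with h | h
  · have := Nat.mul_le_mul_right (bg Gᶜ) h
    omega
  · have := Nat.mul_le_mul_left (bg G) h
    omega

end BurningGame
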